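/- arXiv:2001.03211 — 2 statements merged into one kernel-verified Lean document; each statement's English description precedes it below -/
import Mathlib

section
/- Under assumptions (A1)–(A4) there exist η₂ > 0, L ≥ 1 and q ∈ (0,1) such that for all x, y ∈ [1−x₀, x₀] with |x − y| < η₂ and every natural number n, 𝔼_x |f^n_ω(x) − f^n_ω(y)| = ∫_Σ |f^n_ω(x) − f^n_ω(y)| dℙ_x(ω) ≤ L·qⁿ·|x − y|. -/
/-
Formalization of the Alsedà–Misiurewicz system setup:
`f0, f1` are the piecewise-linear interval homeomorphisms, `iter` the random
iteration along ω ∈ Σ = {0,1}^ℕ, `IsKernel` characterises the family x ↦ ℙ_x by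
its values on cylinder sets, `Pop` is the Markov operator (as a set function),
`Stationary` expresses P-invariance for probability measures on (0,1), `U` is
the dual operator, and `A1`–`A4` are the assumptions of the paper.
-/

open MeasureTheory Filter Set
open scoped ENNReal Topology

namespace AM

noncomputable def f0 (x₀ y₀ : ℝ) (x : ℝ) : ℝ :=
  if x ≤ x₀ then (y₀ / x₀) * x else ((1 - y₀) / (1 - x₀)) * (x - 1) + 1

noncomputable def f1 (x₀ y₀ : ℝ) (x : ℝ) : ℝ := 1 - f0 x₀ y₀ (1 - x)

/-- `fb b` is `f₁` if `b = true`, and `f₀` if `b = false`. -/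
noncomputable def fb (x₀ y₀ : ℝ) (b : Bool) : ℝ → ℝ :=
  if b then f1 x₀ y₀ else f0 x₀ y₀

/-- `iter x₀ y₀ ω n x = f^n_ω(x) = f_{ω (n-1)} ∘ ⋯ ∘ f_{ω 0} (x)`, with `f^0_ω = id`. -/
noncomputable def iter (x₀ y₀ : ℝ) (ω : ℕ → Bool) : ℕ → ℝ → ℝ
  | 0, x => x
  | n + 1, x => fb x₀ y₀ (ω n) (iter x₀ y₀ ω n x)

/-- `cylProb x₀ y₀ p₀ p₁ x w = p_{i₁}(x) p_{i₂}(f_{i₁} x) ⋯` for the word `w = (i₁, …, i_k)`. -/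
noncomputable def cylProb (x₀ y₀ : ℝ) (p₀ p₁ : ℝ → ℝ) : ℝ → List Bool → ℝ
  | _, [] => 1
  | x, b :: w => (if b then p₁ x else p₀ x) * cylProb x₀ y₀ p₀ p₁ (fb x₀ y₀ b x) w

/-- The cylinder set of sequences starting with the word `w`. -/
def cyl (w : List Bool) : Set (ℕ → Bool) := {ω | ∀ j : Fin w.length, ω j = w.get j}

/-- `IsKernel x₀ y₀ p₀ p₁ Pm` says that `Pm x = ℙ_x` for all `x ∈ (0,1)`, i.e. `Pm x` gives
every cylinder set its prescribed probability (this determines `Pm x` uniquely and makes it a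
probability measure, since the empty word gives `Pm x univ = 1`). -/
def IsKernel (x₀ y₀ : ℝ) (p₀ p₁ : ℝ → ℝ) (Pm : ℝ → Measure (ℕ → Bool)) : Prop :=
  ∀ x ∈ Ioo (0:ℝ) 1, ∀ w : List Bool,
    Pm x (cyl w) = ENNReal.ofReal (cylProb x₀ y₀ p₀ p₁ x w)

/-- The Markov operator `P`, as a set function:
`Pop μ A = ∫_{f₀⁻¹(A)} p₀ dμ + ∫_{f₁⁻¹(A)} p₁ dμ`. -/
noncomputable def Pop (x₀ y₀ : ℝ) (p₀ p₁ : ℝ → ℝ) (μ : Measure ℝ) (A : Set ℝ) : ℝ≥0∞ :=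
  (∫⁻ x in f0 x₀ y₀ ⁻¹' A, ENNReal.ofReal (p₀ x) ∂μ) +
    ∫⁻ x in f1 x₀ y₀ ⁻¹' A, ENNReal.ofReal (p₁ x) ∂μ

/-- A stationary (P-invariant) Borel probability measure on (0,1). -/
def Stationary (x₀ y₀ : ℝ) (p₀ p₁ : ℝ → ℝ) (μ : Measure ℝ) : Prop :=
  IsProbabilityMeasure μ ∧ μ (Ioo 0 1) = 1 ∧
    ∀ A : Set ℝ, MeasurableSet A → A ⊆ Ioo 0 1 → μ A = Pop x₀ y₀ p₀ p₁ μ A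

/-- The dual operator `Uφ(x) = p₀(x) φ(f₀ x) + p₁(x) φ(f₁ x)`. -/
noncomputable def U (x₀ y₀ : ℝ) (p₀ p₁ : ℝ → ℝ) (φ : ℝ → ℝ) : ℝ → ℝ :=
  fun x => p₀ x * φ (f0 x₀ y₀ x) + p₁ x * φ (f1 x₀ y₀ x)

/-- Assumption (A1): `1/2 < x₀ < 1` and `1/2 ≤ y₀ < x₀`. -/
def A1 (x₀ y₀ : ℝ) : Prop := 1/2 < x₀ ∧ x₀ < 1 ∧ 1/2 ≤ y₀ ∧ y₀ < x₀

/-- Assumption (A2): Dini continuity of `p₀, p₁`; `β` is a modulus of continuity for both, with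
`∑ₙ β(C tⁿ) < ∞` for all `C ≥ 0`, `0 < t < 1`. (Such a `β` exists iff the least modulus of
continuity has this summability property.) -/
def A2 (p₀ p₁ : ℝ → ℝ) : Prop :=
  ∃ β : ℝ → ℝ,
    (∀ t : ℝ, ∀ x ∈ Icc (0:ℝ) 1, ∀ y ∈ Icc (0:ℝ) 1, |x - y| ≤ t →
      |p₀ x - p₀ y| ≤ β t ∧ |p₁ x - p₁ y| ≤ β t) ∧
    (∀ C : ℝ, 0 ≤ C → ∀ t : ℝ, 0 < t → t < 1 → Summable fun n : ℕ => β (C * t ^ n))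

/-- Assumption (A3): `p₀, p₁` are continuous, `p₀ + p₁ = 1`, and `0 < pᵢ < 1` on `[0,1]`. -/
def A3 (p₀ p₁ : ℝ → ℝ) : Prop :=
  ContinuousOn p₀ (Icc 0 1) ∧ ContinuousOn p₁ (Icc 0 1) ∧
    ∀ x ∈ Icc (0:ℝ) 1, p₀ x + p₁ x = 1 ∧ 0 < p₀ x ∧ p₀ x < 1 ∧ 0 < p₁ x ∧ p₁ x < 1

/-- Assumption (A4): the average Lyapunov exponents at 0 and 1 are positive
(`a₀ = y₀/x₀`, `a₁ = (1-y₀)/(1-x₀)`). -/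
def A4 (x₀ y₀ : ℝ) (p₀ p₁ : ℝ → ℝ) : Prop :=
  0 < p₀ 0 * Real.log (y₀ / x₀) + p₁ 0 * Real.log ((1 - y₀) / (1 - x₀)) ∧
    0 < p₀ 1 * Real.log ((1 - y₀) / (1 - x₀)) + p₁ 1 * Real.log (y₀ / x₀)

/-- The Markov operator of the pair `(x, y)` moved by a common map, chosen according to `x`. -/
noncomputable def coupled (x₀ y₀ : ℝ) (p₀ p₁ : ℝ → ℝ) (Φ : ℝ → ℝ → ℝ) (x y : ℝ) : ℝ :=
  p₀ x * Φ (f0 x₀ y₀ x) (f0 x₀ y₀ y) + p₁ x * Φ (f1 x₀ y₀ x) (f1 x₀ y₀ y)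

/-- `wordIter x₀ y₀ w x` applies the maps coded by the word `w` to `x`, first letter first. -/
noncomputable def wordIter (x₀ y₀ : ℝ) : List Bool → ℝ → ℝ
  | [], x => x
  | b :: w, x => wordIter x₀ y₀ w (fb x₀ y₀ b x)

lemma iter_succ_eq (x₀ y₀ : ℝ) (ω : ℕ → Bool) (n : ℕ) (x : ℝ) :
    iter x₀ y₀ ω (n + 1) x = iter x₀ y₀ (fun i => ω (i + 1)) n (fb x₀ y₀ (ω 0) x) := by
  induction n with
  | zero => rfl
  | succ n ih => rw [iter, ih]; rfl

lemma iter_eq_wordIter (x₀ y₀ : ℝ) (n : ℕ) (ω : ℕ → Bool) (x : ℝ) :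
    iter x₀ y₀ ω n x = wordIter x₀ y₀ (List.ofFn fun i : Fin n => ω i) x := by
  induction n generalizing ω x with
  | zero => rfl
  | succ n ih => rw [iter_succ_eq, ih, List.ofFn_succ]; rfl

lemma sum_cylProb_mul (x₀ y₀ : ℝ) (p₀ p₁ : ℝ → ℝ) (Φ : ℝ → ℝ → ℝ) (n : ℕ) (x y : ℝ) :
    ∑ w : Fin n → Bool, cylProb x₀ y₀ p₀ p₁ x (List.ofFn w) *
      Φ (wordIter x₀ y₀ (List.ofFn w) x) (wordIter x₀ y₀ (List.ofFn w) y) =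
    (coupled x₀ y₀ p₀ p₁)^[n] Φ x y := by
  induction n generalizing x y with
  | zero => simp [cylProb, wordIter]
  | succ n ih =>
    rw [Function.iterate_succ_apply', coupled, ← ih, ← ih,
      ← (Fin.consEquiv fun _ : Fin (n + 1) => Bool).sum_comp, Fintype.sum_prod_type,
      Fintype.sum_bool, add_comm]
    simp [Fin.consEquiv, cylProb, wordIter, fb, Finset.mul_sum, mul_assoc]

lemma cylProb_nonneg {x₀ y₀ : ℝ} {p₀ p₁ : ℝ → ℝ} {s : Set ℝ}
    (hp₀ : ∀ x ∈ s, 0 ≤ p₀ x) (hp₁ : ∀ x ∈ s, 0 ≤ p₁ x)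
    (hs : ∀ b, MapsTo (fb x₀ y₀ b) s s) (w : List Bool) {x : ℝ} (hx : x ∈ s) :
    0 ≤ cylProb x₀ y₀ p₀ p₁ x w := by
  induction w generalizing x with
  | nil => simp [cylProb]
  | cons b w ih =>
    refine mul_nonneg ?_ (ih (hs b hx))
    cases b
    · simpa using hp₀ x hx
    · simpa using hp₁ x hx

lemma integral_iter_eq {x₀ y₀ : ℝ} {p₀ p₁ : ℝ → ℝ} {Pm : ℝ → Measure (ℕ → Bool)}
    (hPm : IsKernel x₀ y₀ p₀ p₁ Pm)
    (hp₀ : ∀ x ∈ Ioo (0 : ℝ) 1, 0 ≤ p₀ x) (hp₁ : ∀ x ∈ Ioo (0 : ℝ) 1, 0 ≤ p₁ x)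
    (hs : ∀ b, MapsTo (fb x₀ y₀ b) (Ioo 0 1) (Ioo 0 1)) (Φ : ℝ → ℝ → ℝ) (n : ℕ)
    {x : ℝ} (hx : x ∈ Ioo (0 : ℝ) 1) (y : ℝ) :
    ∫ ω, Φ (iter x₀ y₀ ω n x) (iter x₀ y₀ ω n y) ∂(Pm x) =
      (coupled x₀ y₀ p₀ p₁)^[n] Φ x y := by
  have hfin : IsFiniteMeasure (Pm x) := by
    refine ⟨?_⟩
    have h := hPm x hx []
    have hu : cyl [] = univ := by ext ω; simp [cyl]
    rw [hu] at h
    rw [h]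
    exact ENNReal.ofReal_lt_top
  have hmeas : Measurable fun (ω : ℕ → Bool) (i : Fin n) => ω i := by fun_prop
  set G : (Fin n → Bool) → ℝ := fun w =>
    Φ (wordIter x₀ y₀ (List.ofFn w) x) (wordIter x₀ y₀ (List.ofFn w) y) with hG
  have hint : ∫ ω, Φ (iter x₀ y₀ ω n x) (iter x₀ y₀ ω n y) ∂(Pm x) =
      ∫ w, G w ∂((Pm x).map fun (ω : ℕ → Bool) (i : Fin n) => ω i) := by
    rw [integral_map hmeas.aemeasurable (by fun_prop)]
    simp only [hG, iter_eq_wordIter]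
  rw [hint, integral_fintype .of_finite, ← sum_cylProb_mul]
  refine Finset.sum_congr rfl fun w _ => ?_
  rw [smul_eq_mul, measureReal_def, Measure.map_apply hmeas (measurableSet_singleton w)]
  have hpre : (fun (ω : ℕ → Bool) (i : Fin n) => ω i) ⁻¹' {w} = cyl (List.ofFn w) := by
    ext ω
    simp only [mem_preimage, mem_singleton_iff, cyl, mem_ofPred_eq, funext_iff]
    constructor
    · intro h j
      simpa using h ⟨j, by simpa using j.2⟩
    · intro h j
      simpa using h ⟨j, by simp⟩
  rw [hpre, hPm x hx, ENNReal.toReal_ofReal (cylProb_nonneg hp₀ hp₁ hs _ hx)]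

/-- The coordinate on `(0,1)` that sends `0` and `1` to `∓∞` logarithmically. Both maps of an
Alsedà–Misiurewicz system are nonexpanding in it. -/
noncomputable def logit (x : ℝ) : ℝ :=
  if x ≤ 1 / 2 then Real.log (2 * x) else -Real.log (2 * (1 - x))

lemma logit_of_le {x : ℝ} (hx : x ≤ 1 / 2) : logit x = Real.log (2 * x) := if_pos hx

lemma logit_of_ge {x : ℝ} (hx : 1 / 2 ≤ x) : logit x = -Real.log (2 * (1 - x)) := by
  rcases hx.eq_or_lt with rfl | hx
  · norm_num [logit]
  · exact if_neg hx.not_ge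

lemma logit_one_sub (x : ℝ) : logit (1 - x) = -logit x := by
  rcases le_total x (1 / 2) with hx | hx
  · rw [logit_of_ge (by linarith), logit_of_le hx, sub_sub_cancel]
  · rw [logit_of_le (by linarith), logit_of_ge hx, neg_neg]

/-- A function that is monotone on the parts of `s` on both sides of a point of `s` is monotone
on `s`. -/
lemma monotoneOn_of_split {f : ℝ → ℝ} {s : Set ℝ} {c : ℝ} (hc : c ∈ s)
    (hl : MonotoneOn f (s ∩ Iic c)) (hr : MonotoneOn f (s ∩ Ici c)) : MonotoneOn f s := by
  intro x hx y hy hxy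
  rcases le_total x c with hxc | hxc <;> rcases le_total y c with hyc | hyc
  · exact hl ⟨hx, hxc⟩ ⟨hy, hyc⟩ hxy
  · exact (hl ⟨hx, hxc⟩ ⟨hc, le_refl c⟩ hxc).trans (hr ⟨hc, le_refl c⟩ ⟨hy, hyc⟩ hyc)
  · rw [le_antisymm (hxy.trans hyc) hxc, le_antisymm hyc (hxc.trans hxy)]
  · exact hr ⟨hx, hxc⟩ ⟨hy, hyc⟩ hxy

lemma sub_le_log_sub_log_mul {x y : ℝ} (hx : 0 < x) (hy : 0 < y) :
    y - x ≤ (Real.log y - Real.log x) * y := by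
  have h := Real.one_sub_inv_le_log_of_pos (div_pos hy hx)
  rw [Real.log_div hy.ne' hx.ne', inv_div] at h
  calc y - x = (1 - x / y) * y := by field_simp
    _ ≤ _ := mul_le_mul_of_nonneg_right h hy.le

lemma log_sub_log_mul_le {x y : ℝ} (hx : 0 < x) (hy : 0 < y) :
    (Real.log y - Real.log x) * x ≤ y - x := by
  linarith [sub_le_log_sub_log_mul hy hx]

lemma monotoneOn_logit_sub_id : MonotoneOn (fun x => logit x - x) (Ioo 0 1) := by
  refine monotoneOn_of_split (c := 1 / 2) (by norm_num) ?_ ?_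
  · rintro x ⟨⟨hx, -⟩, hx'⟩ y ⟨⟨hy, -⟩, hy'⟩ hxy
    simp only [mem_Iic] at hx' hy'
    have h := sub_le_log_sub_log_mul (x := 2 * x) (y := 2 * y) (by linarith) (by linarith)
    have h0 : Real.log (2 * x) ≤ Real.log (2 * y) := Real.log_le_log (by linarith) (by linarith)
    simp only [logit_of_le hx', logit_of_le hy']
    nlinarith
  · rintro x ⟨⟨-, hx⟩, hx'⟩ y ⟨⟨-, hy⟩, hy'⟩ hxy
    simp only [mem_Ici] at hx' hy'
    have h := sub_le_log_sub_log_mul (x := 2 * (1 - y)) (y := 2 * (1 - x)) (by linarith)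
      (by linarith)
    have h0 : Real.log (2 * (1 - y)) ≤ Real.log (2 * (1 - x)) :=
      Real.log_le_log (by linarith) (by linarith)
    simp only [logit_of_ge hx', logit_of_ge hy']
    nlinarith

lemma strictMonoOn_logit : StrictMonoOn logit (Ioo 0 1) := fun x hx y hy hxy => by
  have := monotoneOn_logit_sub_id hx hy hxy.le
  simp only at this
  linarith

lemma abs_sub_le_abs_logit_sub {x y : ℝ} (hx : x ∈ Ioo (0 : ℝ) 1) (hy : y ∈ Ioo (0 : ℝ) 1) :
    |x - y| ≤ |logit x - logit y| := by
  wlog hxy : y ≤ x generalizing x y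
  · rw [abs_sub_comm x, abs_sub_comm (logit x)]
    exact this hy hx (le_of_not_ge hxy)
  have := monotoneOn_logit_sub_id hy hx hxy
  simp only at this
  rw [abs_of_nonneg (by linarith), abs_of_nonneg (by linarith)]
  linarith

lemma abs_logit_sub_le {d x y : ℝ} (hd : 0 < d) (hx : x ∈ Icc d (1 - d)) (hy : y ∈ Icc d (1 - d)) :
    |logit x - logit y| ≤ 1 / d * |x - y| := by
  have hmono : MonotoneOn (fun x => x - d * logit x) (Icc d (1 - d)) := by
    have hd2 : d ≤ 1 / 2 := by linarith [hx.1, hx.2]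
    refine monotoneOn_of_split (c := 1 / 2) ⟨hd2, by linarith⟩ ?_ ?_
    · rintro x ⟨⟨hx, -⟩, hx'⟩ y ⟨⟨hy, -⟩, hy'⟩ hxy
      simp only [mem_Iic] at hx' hy'
      have h := log_sub_log_mul_le (x := 2 * x) (y := 2 * y) (by linarith) (by linarith)
      have h0 : Real.log (2 * x) ≤ Real.log (2 * y) :=
        Real.log_le_log (by linarith) (by linarith)
      simp only [logit_of_le hx', logit_of_le hy']
      nlinarith
    · rintro x ⟨⟨-, hx⟩, hx'⟩ y ⟨⟨-, hy⟩, hy'⟩ hxy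
      simp only [mem_Ici] at hx' hy'
      have h := log_sub_log_mul_le (x := 2 * (1 - y)) (y := 2 * (1 - x)) (by linarith)
        (by linarith)
      have h0 : Real.log (2 * (1 - y)) ≤ Real.log (2 * (1 - x)) :=
        Real.log_le_log (by linarith) (by linarith)
      simp only [logit_of_ge hx', logit_of_ge hy']
      nlinarith
  have hsub : Icc d (1 - d) ⊆ Ioo 0 1 := fun z hz => ⟨hd.trans_le hz.1, by linarith [hz.2]⟩
  wlog hxy : y ≤ x generalizing x y
  · rw [abs_sub_comm x, abs_sub_comm (logit x)]
    exact this hy hx (le_of_not_ge hxy)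
  have h1 := hmono hy hx hxy
  have h2 := strictMonoOn_logit.monotoneOn (hsub hy) (hsub hx) hxy
  simp only at h1
  rw [abs_of_nonneg (by linarith), abs_of_nonneg (by linarith), div_mul_eq_mul_div, one_mul,
    le_div_iff₀ hd]
  linarith

section Maps

variable {x₀ y₀ : ℝ}

lemma f0_eq_left {x : ℝ} (hx : x ≤ x₀) : f0 x₀ y₀ x = y₀ / x₀ * x := if_pos hx

lemma f0_eq_right (hA : A1 x₀ y₀) {x : ℝ} (hx : x₀ ≤ x) :
    f0 x₀ y₀ x = 1 - (1 - y₀) / (1 - x₀) * (1 - x) := by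
  obtain ⟨h1, h2, h3, h4⟩ := hA
  rcases hx.eq_or_lt with rfl | hx
  · rw [f0_eq_left le_rfl, div_mul_cancel₀ _ (by linarith), div_mul_cancel₀ _ (by linarith)]
    ring
  · rw [f0, if_neg hx.not_ge]
    ring

lemma slope_left_pos (hA : A1 x₀ y₀) : 0 < y₀ / x₀ := by
  obtain ⟨h1, h2, h3, h4⟩ := hA
  exact div_pos (by linarith) (by linarith)

lemma slope_left_lt_one (hA : A1 x₀ y₀) : y₀ / x₀ < 1 := by
  obtain ⟨h1, h2, h3, h4⟩ := hA
  exact (div_lt_one (by linarith)).2 h4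

lemma one_lt_slope_right (hA : A1 x₀ y₀) : 1 < (1 - y₀) / (1 - x₀) := by
  obtain ⟨h1, h2, h3, h4⟩ := hA
  exact (one_lt_div (by linarith)).2 (by linarith)

lemma slope_left_mul (hA : A1 x₀ y₀) : y₀ / x₀ * x₀ = y₀ :=
  div_mul_cancel₀ _ (by linarith [hA.1])

lemma slope_right_mul (hA : A1 x₀ y₀) : (1 - y₀) / (1 - x₀) * (1 - x₀) = 1 - y₀ :=
  div_mul_cancel₀ _ (by linarith [hA.2.1])

lemma f0_mem (hA : A1 x₀ y₀) {x : ℝ} (hx : x ∈ Ioo (0 : ℝ) 1) : f0 x₀ y₀ x ∈ Ioo (0 : ℝ) 1 := by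
  have ha := slope_left_pos hA
  have ha' := slope_left_lt_one hA
  have hb := one_lt_slope_right hA
  have hbm := slope_right_mul hA
  obtain ⟨h1, h2, h3, h4⟩ := id hA
  obtain ⟨hx0, hx1⟩ := hx
  rcases le_total x x₀ with h | h
  · rw [f0_eq_left h]
    constructor <;> nlinarith
  · rw [f0_eq_right hA h]
    constructor <;> nlinarith

lemma monotone_f0 (hA : A1 x₀ y₀) : Monotone (f0 x₀ y₀) := by
  rw [← monotoneOn_univ]
  have ha := slope_left_pos hA
  have hb := one_lt_slope_right hA
  refine monotoneOn_of_split (c := x₀) (mem_univ _) ?_ ?_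
  · rintro x ⟨-, hx⟩ y ⟨-, hy⟩ hxy
    rw [f0_eq_left hx, f0_eq_left hy]
    exact mul_le_mul_of_nonneg_left hxy ha.le
  · rintro x ⟨-, hx⟩ y ⟨-, hy⟩ hxy
    rw [f0_eq_right hA hx, f0_eq_right hA hy]
    nlinarith

/-- The distance by which `f0` moves a point to the left, in the coordinate `logit`. -/
noncomputable def disp (x₀ y₀ x : ℝ) : ℝ := logit x - logit (f0 x₀ y₀ x)

lemma disp_left (hA : A1 x₀ y₀) {x : ℝ} (hx : 0 < x) (hx' : x ≤ 1 / 2) :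
    disp x₀ y₀ x = -Real.log (y₀ / x₀) := by
  have ha := slope_left_pos hA
  have ha' := slope_left_lt_one hA
  rw [disp, f0_eq_left (by linarith [hA.1]), logit_of_le hx', logit_of_le (by nlinarith),
    mul_left_comm, Real.log_mul ha.ne' (by positivity)]
  ring

lemma disp_right (hA : A1 x₀ y₀) {x : ℝ} (hx : x₀ ≤ x) (hx' : x < 1) :
    disp x₀ y₀ x = Real.log ((1 - y₀) / (1 - x₀)) := by
  have hb := one_lt_slope_right hA
  have hbm := slope_right_mul hA
  have h1x : 0 < 1 - x := by linarith
  obtain ⟨h1, h2, h3, h4⟩ := id hA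
  rw [disp, f0_eq_right hA hx, logit_of_ge (by linarith), logit_of_ge (by nlinarith),
    sub_sub_cancel, mul_left_comm,
    Real.log_mul (x := (1 - y₀) / (1 - x₀)) (by positivity) (by positivity)]
  ring

/-- The point that `f0` maps to `1/2`. -/
noncomputable def half (x₀ y₀ : ℝ) : ℝ := x₀ / (2 * y₀)

lemma slope_left_mul_half (hA : A1 x₀ y₀) : y₀ / x₀ * half x₀ y₀ = 1 / 2 := by
  obtain ⟨h1, h2, h3, h4⟩ := hA
  have : x₀ ≠ 0 := by linarith
  have : y₀ ≠ 0 := by linarith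
  rw [half]
  field_simp

lemma half_le (hA : A1 x₀ y₀) : half x₀ y₀ ≤ x₀ := by
  obtain ⟨h1, h2, h3, h4⟩ := hA
  exact div_le_self (by linarith) (by linarith)

lemma half_gt (hA : A1 x₀ y₀) : 1 / 2 < half x₀ y₀ := by
  nlinarith [slope_left_mul_half hA, slope_left_pos hA, slope_left_lt_one hA]

lemma disp_middle (hA : A1 x₀ y₀) {x : ℝ} (hx : 1 / 2 ≤ x) (hx' : x ≤ half x₀ y₀) :
    disp x₀ y₀ x = -Real.log (2 * (1 - x)) - Real.log (2 * x) - Real.log (y₀ / x₀) := by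
  have ha := slope_left_pos hA
  have hh := slope_left_mul_half hA
  have hv := half_le hA
  rw [disp, f0_eq_left (hx'.trans hv), logit_of_ge hx, logit_of_le (by nlinarith), mul_left_comm,
    Real.log_mul ha.ne' (by positivity)]
  ring

lemma monotoneOn_disp (hA : A1 x₀ y₀) : MonotoneOn (disp x₀ y₀) (Ioo 0 1) := by
  have ha := slope_left_pos hA
  have ha' := slope_left_lt_one hA
  have hh := slope_left_mul_half hA
  have hv := half_le hA
  have hv' := half_gt hA
  obtain ⟨h1, h2, h3, h4⟩ := id hA
  refine monotoneOn_of_split (c := x₀) ⟨by linarith, h2⟩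
    (monotoneOn_of_split (c := 1 / 2) ⟨by norm_num, h1.le⟩ ?_
      (monotoneOn_of_split (c := half x₀ y₀) ⟨⟨⟨by linarith, by linarith⟩, hv⟩, hv'.le⟩ ?_ ?_)) ?_
  · rintro x ⟨⟨hx, -⟩, hx'⟩ y ⟨⟨hy, -⟩, hy'⟩ -
    rw [disp_left hA hx.1 hx', disp_left hA hy.1 hy']
  · rintro x ⟨⟨⟨hx, -⟩, hxl⟩, hxr⟩ y ⟨⟨⟨hy, -⟩, hyl⟩, hyr⟩ hxy
    obtain ⟨hx0, hx1⟩ := hx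
    obtain ⟨hy0, hy1⟩ := hy
    simp only [mem_Ici] at hxl hyl
    rw [disp_middle hA hxl hxr, disp_middle hA hyl hyr]
    have := Real.log_le_log (x := 2 * (1 - y) * (2 * y)) (y := 2 * (1 - x) * (2 * x))
      (by apply mul_pos <;> linarith) (by nlinarith)
    rw [Real.log_mul (x := 2 * (1 - y)) (by linarith) (by linarith),
      Real.log_mul (x := 2 * (1 - x)) (by linarith) (by linarith)] at this
    linarith
  · rintro x ⟨⟨⟨hx, hxr⟩, hxh⟩, hxl⟩ y ⟨⟨⟨hy, hyr⟩, hyh⟩, hyl⟩ hxy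
    obtain ⟨hx0, hx1⟩ := hx
    obtain ⟨hy0, hy1⟩ := hy
    simp only [mem_Ici, mem_Iic] at hxl hyl hxr hyr hxh hyh
    rw [disp, disp, f0_eq_left hxr, f0_eq_left hyr, logit_of_ge hxh, logit_of_ge hyh,
      logit_of_ge (by nlinarith), logit_of_ge (by nlinarith)]
    have e1 : 0 < 1 - y₀ / x₀ * x := by nlinarith
    have e2 : 0 < 1 - y₀ / x₀ * y := by nlinarith
    have := Real.log_le_log (x := 2 * (1 - y₀ / x₀ * x) * (2 * (1 - y)))
      (y := 2 * (1 - y₀ / x₀ * y) * (2 * (1 - x)))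
      (by apply mul_pos <;> linarith) (by nlinarith)
    rw [Real.log_mul (x := 2 * (1 - y₀ / x₀ * x)) (by linarith) (by linarith),
      Real.log_mul (x := 2 * (1 - y₀ / x₀ * y)) (by linarith) (by linarith)] at this
    linarith
  · rintro x ⟨hx, hx'⟩ y ⟨hy, hy'⟩ -
    rw [disp_right hA hx' hx.2, disp_right hA hy' hy.2]

lemma disp_ge (hA : A1 x₀ y₀) {x : ℝ} (hx : x ∈ Ioo (0 : ℝ) 1) :
    -Real.log (y₀ / x₀) ≤ disp x₀ y₀ x := by
  rcases le_total x (1 / 2) with h | h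
  · exact (disp_left hA hx.1 h).ge
  · rw [← disp_left hA (x := 1 / 2) (by norm_num) le_rfl]
    exact monotoneOn_disp hA (by norm_num) hx h

lemma disp_le (hA : A1 x₀ y₀) {x : ℝ} (hx : x ∈ Ioo (0 : ℝ) 1) :
    disp x₀ y₀ x ≤ Real.log ((1 - y₀) / (1 - x₀)) := by
  obtain ⟨h1, h2, h3, h4⟩ := id hA
  rcases le_total x x₀ with h | h
  · rw [← disp_right hA le_rfl h2]
    exact monotoneOn_disp hA hx ⟨by linarith, h2⟩ h
  · exact (disp_right hA h hx.2).le

lemma logit_f0 (x : ℝ) : logit (f0 x₀ y₀ x) = logit x - disp x₀ y₀ x := by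
  rw [disp, sub_sub_cancel]

lemma logit_f1 (x : ℝ) : logit (f1 x₀ y₀ x) = logit x + disp x₀ y₀ (1 - x) := by
  rw [f1, logit_one_sub, disp, logit_one_sub x]
  ring

lemma one_sub_mem {x : ℝ} (hx : x ∈ Ioo (0 : ℝ) 1) : 1 - x ∈ Ioo (0 : ℝ) 1 :=
  ⟨by linarith [hx.2], by linarith [hx.1]⟩

lemma f1_mem (hA : A1 x₀ y₀) {x : ℝ} (hx : x ∈ Ioo (0 : ℝ) 1) : f1 x₀ y₀ x ∈ Ioo (0 : ℝ) 1 :=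
  one_sub_mem (f0_mem hA (one_sub_mem hx))

lemma monotone_f1 (hA : A1 x₀ y₀) : Monotone (f1 x₀ y₀) := fun x y hxy => by
  have := monotone_f0 hA (show 1 - y ≤ 1 - x by linarith)
  simp only [f1]
  linarith

lemma abs_logit_f0_sub_le (hA : A1 x₀ y₀) {x y : ℝ} (hx : x ∈ Ioo (0 : ℝ) 1)
    (hy : y ∈ Ioo (0 : ℝ) 1) :
    |logit (f0 x₀ y₀ x) - logit (f0 x₀ y₀ y)| ≤ |logit x - logit y| := by
  wlog hxy : y ≤ x generalizing x y
  · rw [abs_sub_comm (logit _), abs_sub_comm (logit x)]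
    exact this hy hx (le_of_not_ge hxy)
  have h1 := strictMonoOn_logit.monotoneOn (f0_mem hA hy) (f0_mem hA hx) (monotone_f0 hA hxy)
  have h2 := strictMonoOn_logit.monotoneOn hy hx hxy
  have h3 := monotoneOn_disp hA hy hx hxy
  rw [abs_of_nonneg (by linarith), abs_of_nonneg (by linarith)]
  simp only [disp] at h3
  linarith

lemma abs_logit_f1_sub_le (hA : A1 x₀ y₀) {x y : ℝ} (hx : x ∈ Ioo (0 : ℝ) 1)
    (hy : y ∈ Ioo (0 : ℝ) 1) :
    |logit (f1 x₀ y₀ x) - logit (f1 x₀ y₀ y)| ≤ |logit x - logit y| := by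
  have := abs_logit_f0_sub_le hA (one_sub_mem hy) (one_sub_mem hx)
  simp only [f1, logit_one_sub] at this ⊢
  convert this using 2 <;> ring

/-- Between `1/2` and the preimage of `1/2`, the map `f0` contracts in the coordinate `logit`,
uniformly away from `1/2`. -/
lemma abs_logit_f0_sub_le_mul (hA : A1 x₀ y₀) {u x y : ℝ} (hu : 1 / 2 ≤ u)
    (hx : x ∈ Icc u (half x₀ y₀)) (hy : y ∈ Icc u (half x₀ y₀)) :
    |logit (f0 x₀ y₀ x) - logit (f0 x₀ y₀ y)| ≤ (1 - u) / u * |logit x - logit y| := by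
  wlog hxy : y ≤ x generalizing x y
  · rw [abs_sub_comm (logit _), abs_sub_comm (logit x)]
    exact this hy hx (le_of_not_ge hxy)
  obtain ⟨hx1, hx2⟩ := hx
  obtain ⟨hy1, hy2⟩ := hy
  have hh := (half_le hA).trans_lt hA.2.1
  have hx' : x ∈ Ioo (0 : ℝ) 1 := ⟨by linarith, by linarith⟩
  have hy' : y ∈ Ioo (0 : ℝ) 1 := ⟨by linarith, by linarith⟩
  have h1 := strictMonoOn_logit.monotoneOn (f0_mem hA hy') (f0_mem hA hx') (monotone_f0 hA hxy)
  have h2 := strictMonoOn_logit.monotoneOn hy' hx' hxy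
  rw [abs_of_nonneg (by linarith), abs_of_nonneg (by linarith), div_mul_eq_mul_div,
    le_div_iff₀ (by linarith), logit_f0, logit_f0, disp_middle hA (hu.trans hx1) hx2,
    disp_middle hA (hu.trans hy1) hy2, logit_of_ge (hu.trans hx1), logit_of_ge (hu.trans hy1)]
  have e1 := log_sub_log_mul_le (x := 2 * y) (y := 2 * x) (by linarith) (by linarith)
  have e2 := sub_le_log_sub_log_mul (x := 2 * (1 - x)) (y := 2 * (1 - y)) (by linarith)
    (by linarith)
  have e3 : Real.log (2 * y) ≤ Real.log (2 * x) := Real.log_le_log (by linarith) (by linarith)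
  have e4 : Real.log (2 * (1 - x)) ≤ Real.log (2 * (1 - y)) :=
    Real.log_le_log (by linarith) (by linarith)
  nlinarith

end Maps

lemma eventually_exp_average_lt_one {p q c l : ℝ} (hpq : p + q = 1) (hneg : q * c < p * l) :
    ∀ᶠ α in 𝓝[>] (0 : ℝ), p * Real.exp (-(α * l)) + q * Real.exp (α * c) < 1 := by
  have hd : HasDerivAt (fun α : ℝ => p * Real.exp (-(α * l)) + q * Real.exp (α * c))
      (p * (Real.exp (-(0 * l)) * -(1 * l)) + q * (Real.exp (0 * c) * (1 * c))) 0 :=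
    ((((hasDerivAt_id 0).mul_const l).neg.exp).const_mul p).add
      ((((hasDerivAt_id 0).mul_const c).exp).const_mul q)
  rw [hasDerivAt_iff_tendsto_slope] at hd
  have hlt := hd.eventually_lt_const (u := 0) (by simp; linarith)
  have hsub : 𝓝[>] (0 : ℝ) ≤ 𝓝[≠] 0 := nhdsWithin_mono _ fun x hx => ne_of_gt hx
  filter_upwards [hsub hlt, self_mem_nhdsWithin] with α hα hpos
  rw [slope_def_field, sub_zero, div_lt_iff₀ hpos] at hα
  simp only [zero_mul, neg_zero, Real.exp_zero, mul_one, hpq] at hα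
  linarith

section Weight

variable {x₀ y₀ : ℝ} {p₀ p₁ : ℝ → ℝ}

/-- Geometric drift of the Markov chain towards the middle of the interval. -/
lemma exists_drift (hA1 : A1 x₀ y₀) (hA3 : A3 p₀ p₁) (hA4 : A4 x₀ y₀ p₀ p₁) :
    ∃ α : ℝ, 0 < α ∧ ∃ r ∈ Ioo (0 : ℝ) 1, ∃ b : ℝ, 0 ≤ b ∧ ∀ x ∈ Ioo (0 : ℝ) 1,
      p₀ x * Real.exp (α * |logit (f0 x₀ y₀ x)|) + p₁ x * Real.exp (α * |logit (f1 x₀ y₀ x)|) ≤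
        r * Real.exp (α * |logit x|) + b := by
  obtain ⟨hc₀, hc₁, hp⟩ := hA3
  set l := Real.log ((1 - y₀) / (1 - x₀)) with hl
  set c := -Real.log (y₀ / x₀) with hc
  have hl0 : 0 < l := Real.log_pos (one_lt_slope_right hA1)
  have h0 : (0 : ℝ) ∈ Icc (0 : ℝ) 1 := by norm_num
  have h1 : (1 : ℝ) ∈ Icc (0 : ℝ) 1 := by norm_num
  obtain ⟨α, ⟨hα1, hα0⟩, hα⟩ := (((eventually_exp_average_lt_one (c := c) (l := l) (hp 1 h1).1
    (by linarith [hA4.2])).and (eventually_exp_average_lt_one (c := c) (l := l)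
      (by linarith [(hp 0 h0).1] : p₁ 0 + p₀ 0 = 1) (by linarith [hA4.1]))).and
      self_mem_nhdsWithin).exists
  replace hα : 0 < α := hα
  obtain ⟨r, hr, hr1⟩ := exists_between (max_lt (max_lt hα1 hα0) one_pos)
  simp only [max_lt_iff] at hr
  obtain ⟨⟨hrα1, hrα0⟩, hr0⟩ := hr
  have hn1 : ∀ᶠ x in 𝓝[Icc 0 1] (1 : ℝ),
      p₀ x * Real.exp (-(α * l)) + p₁ x * Real.exp (α * c) < r :=
    (((hc₀ 1 h1).mul_const _).add ((hc₁ 1 h1).mul_const _)).eventually_lt_const hrα1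
  have hn0 : ∀ᶠ x in 𝓝[Icc 0 1] (0 : ℝ),
      p₁ x * Real.exp (-(α * l)) + p₀ x * Real.exp (α * c) < r :=
    (((hc₁ 0 h0).mul_const _).add ((hc₀ 0 h0).mul_const _)).eventually_lt_const hrα0
  obtain ⟨δ₁, hδ₁, hn1⟩ := Metric.mem_nhdsWithin_iff.1 hn1
  obtain ⟨δ₀, hδ₀, hn0⟩ := Metric.mem_nhdsWithin_iff.1 hn0
  obtain ⟨hA11, hA12, hA13, hA14⟩ := id hA1
  obtain ⟨d, hd0, hd⟩ := exists_between (lt_min (lt_min hδ₁ hδ₀) (sub_pos.2 hA12))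
  simp only [lt_min_iff] at hd
  obtain ⟨⟨hdδ₁, hdδ₀⟩, hdx⟩ := hd
  have hd_mem : d ∈ Ioo (0 : ℝ) 1 := ⟨hd0, by linarith⟩
  refine ⟨α, hα, r, ⟨hr0, hr1⟩, Real.exp (α * (-logit d + l)), (Real.exp_pos _).le,
    fun x hx => ?_⟩
  have hb := (Real.exp_pos (α * (-logit d + l))).le
  have hx' := one_sub_mem hx
  have hxI : x ∈ Icc (0 : ℝ) 1 := Ioo_subset_Icc_self hx
  obtain ⟨hpsum, hp₀, -, hp₁, -⟩ := hp x hxI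
  rcases le_total x d with hxd | hxd
  · have hlow : p₁ x * Real.exp (-(α * l)) + p₀ x * Real.exp (α * c) < r := by
      refine hn0 ⟨?_, hxI⟩
      rw [Metric.mem_ball, Real.dist_eq, sub_zero, abs_of_pos hx.1]
      linarith
    have e1 : logit (f1 x₀ y₀ x) = logit x + l := by
      rw [logit_f1, disp_right hA1 (by linarith) hx'.2]
    have e0 : logit (f0 x₀ y₀ x) = logit x - c := by
      rw [logit_f0, disp_left hA1 hx.1 (by linarith)]
    have hs1 : logit (f1 x₀ y₀ x) ≤ 0 := by
      have hge : f0 x₀ y₀ x₀ ≤ f0 x₀ y₀ (1 - x) := monotone_f0 hA1 (by linarith)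
      rw [f0_eq_left le_rfl, slope_left_mul hA1] at hge
      have hle : f1 x₀ y₀ x ≤ 1 / 2 := by rw [f1]; linarith
      rw [logit_of_le hle]
      exact Real.log_nonpos (by linarith [(f1_mem hA1 hx).1]) (by linarith)
    have hc0 : 0 < c := neg_pos.2 (Real.log_neg (slope_left_pos hA1) (slope_left_lt_one hA1))
    rw [abs_of_nonpos hs1, e1, abs_of_nonpos (by linarith : logit x ≤ 0),
      abs_of_nonpos (by linarith : logit (f0 x₀ y₀ x) ≤ 0), e0,
      show α * -(logit x - c) = α * c + α * -logit x by ring,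
      show α * -(logit x + l) = -(α * l) + α * -logit x by ring, Real.exp_add, Real.exp_add]
    nlinarith [Real.exp_pos (α * -logit x)]
  rcases le_total (1 - d) x with hxd' | hxd'
  · have hlow : p₀ x * Real.exp (-(α * l)) + p₁ x * Real.exp (α * c) < r := by
      refine hn1 ⟨?_, hxI⟩
      rw [Metric.mem_ball, Real.dist_eq, abs_sub_comm, abs_of_pos hx'.1]
      linarith
    have e0 : logit (f0 x₀ y₀ x) = logit x - l := by
      rw [logit_f0, disp_right hA1 (by linarith) hx.2]
    have e1 : logit (f1 x₀ y₀ x) = logit x + c := by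
      rw [logit_f1, disp_left hA1 hx'.1 (by linarith)]
    have hs0 : 0 ≤ logit (f0 x₀ y₀ x) := by
      have hge : f0 x₀ y₀ x₀ ≤ f0 x₀ y₀ x := monotone_f0 hA1 (by linarith)
      rw [f0_eq_left le_rfl, slope_left_mul hA1] at hge
      rw [logit_of_ge (hA13.trans hge)]
      exact neg_nonneg.2 (Real.log_nonpos (by linarith [(f0_mem hA1 hx).2]) (by linarith))
    have hc0 : 0 < c := neg_pos.2 (Real.log_neg (slope_left_pos hA1) (slope_left_lt_one hA1))
    rw [abs_of_nonneg hs0, e0, abs_of_nonneg (by linarith : 0 ≤ logit x),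
      abs_of_nonneg (by linarith : 0 ≤ logit (f1 x₀ y₀ x)), e1,
      show α * (logit x - l) = -(α * l) + α * logit x by ring,
      show α * (logit x + c) = α * c + α * logit x by ring, Real.exp_add, Real.exp_add]
    nlinarith [Real.exp_pos (α * logit x)]
  · have hm := strictMonoOn_logit.monotoneOn
    have t1 := hm hd_mem hx hxd
    have t2 := hm hx (one_sub_mem hd_mem) hxd'
    rw [logit_one_sub] at t2
    have k1 := disp_le hA1 hx
    have k2 := disp_ge hA1 hx
    have k3 := disp_le hA1 hx'
    have k4 := disp_ge hA1 hx'
    have hc0 : 0 < c := neg_pos.2 (Real.log_neg (slope_left_pos hA1) (slope_left_lt_one hA1))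
    have g0 : Real.exp (α * |logit (f0 x₀ y₀ x)|) ≤ Real.exp (α * (-logit d + l)) := by
      refine Real.exp_le_exp.2 (mul_le_mul_of_nonneg_left ?_ hα.le)
      rw [logit_f0]
      exact abs_le.2 ⟨by linarith, by linarith⟩
    have g1 : Real.exp (α * |logit (f1 x₀ y₀ x)|) ≤ Real.exp (α * (-logit d + l)) := by
      refine Real.exp_le_exp.2 (mul_le_mul_of_nonneg_left ?_ hα.le)
      rw [logit_f1]
      exact abs_le.2 ⟨by linarith, by linarith⟩
    have g2 := mul_pos hr0 (Real.exp_pos (α * |logit x|))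
    calc _ ≤ p₀ x * Real.exp (α * (-logit d + l)) + p₁ x * Real.exp (α * (-logit d + l)) :=
          add_le_add (mul_le_mul_of_nonneg_left g0 hp₀.le) (mul_le_mul_of_nonneg_left g1 hp₁.le)
      _ = Real.exp (α * (-logit d + l)) := by rw [← add_mul, hpsum, one_mul]
      _ ≤ _ := by linarith

lemma exists_prob_lower_bound (hA3 : A3 p₀ p₁) :
    ∃ m : ℝ, 0 < m ∧ ∀ x ∈ Icc (0 : ℝ) 1, m ≤ p₀ x ∧ m ≤ p₁ x := by
  obtain ⟨hc₀, hc₁, hp⟩ := hA3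
  obtain ⟨z₀, hz₀, h₀⟩ := isCompact_Icc.exists_isMinOn (by simp) hc₀
  obtain ⟨z₁, hz₁, h₁⟩ := isCompact_Icc.exists_isMinOn (by simp) hc₁
  exact ⟨min (p₀ z₀) (p₁ z₁), lt_min (hp z₀ hz₀).2.1 (hp z₁ hz₁).2.2.2.1, fun x hx =>
    ⟨(min_le_left _ _).trans (h₀ hx), (min_le_right _ _).trans (h₁ hx)⟩⟩

/-- A positive function which grows at least by the factor `2 / m` along steps to the right ending
left of `w`, and along steps to the left starting right of `w`. -/
lemma exists_growth_function {m c l w : ℝ} (hm : 0 < m) (hc : 0 < c) (hw : 0 ≤ w) :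
    ∃ φ : ℝ → ℝ, (∀ t, 0 < φ t) ∧ (∃ M : ℝ, ∀ t, φ t ≤ M) ∧
      (∀ R : ℝ, ∃ ε : ℝ, 0 < ε ∧ ∀ t, |t| ≤ R → ε ≤ φ t) ∧
      (∀ s t : ℝ, s + c ≤ t → t ≤ w → 2 * φ s ≤ m * φ t) ∧
      ∀ s t : ℝ, w < s → t ≤ s - c → s - l ≤ t → 2 * φ s ≤ m * φ t := by
  set θ := 2 / m / c with hθ
  have hθ0 : 0 < θ := by positivity
  have hgrow : 2 ≤ m * Real.exp (θ * c) := by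
    have h := Real.add_one_le_exp (θ * c)
    rw [hθ, div_mul_cancel₀ _ hc.ne'] at h ⊢
    calc (2 : ℝ) = m * (2 / m) := by field_simp
      _ ≤ _ := mul_le_mul_of_nonneg_left (by linarith) hm.le
  have key : ∀ u v : ℝ, u + θ * c ≤ v → 2 * Real.exp u ≤ m * Real.exp v := fun u v huv => by
    have h := Real.exp_le_exp.2 huv
    rw [Real.exp_add] at h
    nlinarith [Real.exp_pos u, mul_le_mul_of_nonneg_left h hm.le]
  refine ⟨fun t => if t ≤ w then Real.exp (θ * t) else Real.exp (-(θ * (t + |l| + c))),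
    fun t => ?_, ⟨Real.exp (θ * w), fun t => ?_⟩, fun R => ⟨Real.exp (-(θ * (R + |l| + c))),
      Real.exp_pos _, fun t ht => ?_⟩, fun s t hst ht => ?_, fun s t hs hst hst' => ?_⟩
  · dsimp only
    split_ifs <;> exact Real.exp_pos _
  · dsimp only
    have := abs_nonneg l
    split_ifs with h <;> apply Real.exp_le_exp.2 <;> nlinarith
  · dsimp only
    have := abs_nonneg l
    obtain ⟨h1, h2⟩ := abs_le.1 ht
    split_ifs with h <;> apply Real.exp_le_exp.2 <;> nlinarith
  · simp only [if_pos ht, if_pos (by linarith : s ≤ w)]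
    exact key _ _ (by nlinarith)
  · simp only [if_neg hs.not_ge]
    have := le_abs_self l
    split_ifs with h <;> apply key <;> nlinarith

/-- There is a window `(u, f1 u]`, which `f1` cannot jump over from the left, where `f0` contracts
pairs of close points in the coordinate `logit`. -/
lemma exists_contracting_window (hA1 : A1 x₀ y₀) :
    ∃ u ∈ Ioo (0 : ℝ) 1, 0 ≤ logit (f1 x₀ y₀ u) ∧ ∃ η : ℝ, 0 < η ∧ ∃ γ : ℝ, 0 ≤ γ ∧ γ < 1 ∧
      ∀ x ∈ Ioo (0 : ℝ) 1, ∀ y ∈ Ioo (0 : ℝ) 1, u < x → x ≤ f1 x₀ y₀ u →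
        |logit x - logit y| < η →
        |logit (f0 x₀ y₀ x) - logit (f0 x₀ y₀ y)| ≤ γ * |logit x - logit y| := by
  have hA11 := hA1.1
  have hA12 := hA1.2.1
  have ha := slope_left_pos hA1
  have ha' := slope_left_lt_one hA1
  have hh := slope_left_mul_half hA1
  have hh' := half_le hA1
  set a := y₀ / x₀ with ha_def
  set v := half x₀ y₀ with hv_def
  have hgap : 0 < v - (1 - a / 2) := by nlinarith [sq_pos_of_pos (sub_pos.2 ha')]
  set u := 1 / 2 + (v - (1 - a / 2)) / 2 with hu
  set u' := 1 / 2 + (v - (1 - a / 2)) / 4 with hu'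
  have hf1u : f1 x₀ y₀ u = 1 - a * (1 - u) := by rw [f1, f0_eq_left (by linarith)]
  have hf1u_lt : f1 x₀ y₀ u < v := by rw [hf1u]; nlinarith
  have hu_mem : u ∈ Ioo (0 : ℝ) 1 := ⟨by linarith, by linarith⟩
  have hu'_mem : u' ∈ Ioo (0 : ℝ) 1 := ⟨by linarith, by linarith⟩
  have hv_mem : v ∈ Ioo (0 : ℝ) 1 := ⟨by linarith, by linarith⟩
  have hf1u_mem := f1_mem hA1 hu_mem
  have hmono := strictMonoOn_logit.monotoneOn
  refine ⟨u, hu_mem, ?_, min (logit u - logit u') (logit v - logit (f1 x₀ y₀ u)),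
    lt_min (sub_pos.2 (strictMonoOn_logit hu'_mem hu_mem (by linarith)))
      (sub_pos.2 (strictMonoOn_logit hf1u_mem hv_mem hf1u_lt)),
    (1 - u') / u', div_nonneg (by linarith) (by linarith),
    (div_lt_one (by linarith)).2 (by linarith), fun x hx y hy hux hxw hxy => ?_⟩
  · have h12 : logit (1 / 2) = 0 := by norm_num [logit]
    rw [← h12]
    exact hmono (by norm_num) hf1u_mem (by rw [hf1u]; nlinarith)
  · have h1 := hmono hu_mem hx hux.le
    have h2 := hmono hx hf1u_mem hxw
    obtain ⟨g1, g2⟩ := lt_min_iff.1 hxy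
    obtain ⟨g3, -⟩ := abs_lt.1 g2
    obtain ⟨-, g4⟩ := abs_lt.1 g1
    have hyu : u' ≤ y := (strictMonoOn_logit.le_iff_le hu'_mem hy).1 (by linarith)
    have hyv : y ≤ v := (strictMonoOn_logit.le_iff_le hy hv_mem).1 (by linarith)
    exact abs_logit_f0_sub_le_mul hA1 (by linarith) ⟨by linarith, by linarith⟩ ⟨hyu, hyv⟩

lemma exists_weight_constants {r b δ φ₀ M : ℝ} (hr1 : r < 1) (hb : 0 ≤ b) (hδ0 : 0 < δ)
    (hδ1 : δ ≤ 1) (hφ₀ : 0 < φ₀) (hM : 0 < M) :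
    ∃ ε B s : ℝ, 0 < ε ∧ 0 < s ∧ s < 1 ∧ ε * b ≤ φ₀ / 2 ∧ M + 1 ≤ B ∧ s ≤ (1 - r) / 4 ∧
      s * B ≤ φ₀ / 2 ∧ s * B ≤ ε * (1 - r) / 4 ∧ s * B + M + ε * b ≤ δ * B := by
  have hr' : 0 < 1 - r := by linarith
  set ε := φ₀ / (2 * (b + 1)) with hε
  have hε0 : 0 < ε := by positivity
  have hεb : ε * (b + 1) = φ₀ / 2 := by rw [hε]; field_simp
  have hεb0 : 0 ≤ ε * b := by positivity
  set B := 2 * (M + ε * b + 1) / δ with hB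
  have hBδ : B * δ = 2 * (M + ε * b + 1) := div_mul_cancel₀ _ hδ0.ne'
  have hB0 : 0 < B := by positivity
  obtain ⟨s, hs0, hs⟩ := exists_between (show (0 : ℝ) < min (min (δ / 2) ((1 - r) / 4))
    (min (φ₀ / 2 / B) (ε * (1 - r) / 4 / B)) by positivity)
  simp only [lt_min_iff, lt_div_iff₀ hB0] at hs
  obtain ⟨⟨hsδ, hsr⟩, hsφ, hsε⟩ := hs
  exact ⟨ε, B, s, hε0, hs0, by linarith, by linarith, by nlinarith, hsr.le, hsφ.le, hsε.le,
    by nlinarith⟩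

lemma weight_average_le_of_growth {B F E ε r b s φ₀ : ℝ} (hr1 : r < 1) (hF0 : 0 < F)
    (hε0 : 0 < ε) (hs0 : 0 < s) (hE : 1 ≤ E) (hsr : s ≤ (1 - r) / 4) (hεb : ε * b ≤ φ₀ / 2)
    (hsφ : s * B ≤ φ₀ / 2) (hsε : s * B ≤ ε * (1 - r) / 4)
    (h : φ₀ ≤ F ∨ b ≤ (1 - r) / 2 * E) :
    B - 2 * F + ε * (r * E + b) ≤ (1 - s) * (B - F + ε * E) := by
  have hsF : 0 < s * F := by positivity
  have hεE : 0 < ε * E := by positivity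
  have hsE : s * (ε * E) ≤ (1 - r) / 4 * (ε * E) := mul_le_mul_of_nonneg_right hsr hεE.le
  have hrE : 0 < (1 - r) * (ε * E) := mul_pos (by linarith) hεE
  rcases h with h | h
  · linarith
  · have e1 := mul_le_mul_of_nonneg_left h hε0.le
    have e2 := mul_le_mul_of_nonneg_left hE
      (by have := mul_pos hε0 (sub_pos.2 hr1); linarith : 0 ≤ ε * (1 - r) / 4)
    linarith

lemma weight_average_le_of_contraction {P₀ P₁ B F F₀ F₁ E E₀ E₁ ε r b s m γ M : ℝ}
    (hP : P₀ + P₁ = 1) (hm : m ≤ P₀) (hP₀ : 0 ≤ P₀) (hP₁ : 0 ≤ P₁) (hγ0 : 0 ≤ γ) (hγ1 : γ ≤ 1)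
    (hB : 0 ≤ B) (hF : 0 < F) (hFM : F ≤ M) (hF₀ : 0 < F₀) (hF₁ : 0 < F₁) (hE : 0 ≤ E)
    (hE₀ : 0 ≤ E₀) (hε : 0 < ε) (hs : 0 < s) (hsr : s ≤ (1 - r) / 4)
    (hav : P₀ * E₀ + P₁ * E₁ ≤ r * E + b) (hsB : s * B + M + ε * b ≤ m * (1 - γ) * B) :
    P₀ * (B - F₀ + ε * E₀) * γ + P₁ * (B - F₁ + ε * E₁) ≤ (1 - s) * (B - F + ε * E) := by
  have b0 := mul_le_mul_of_nonneg_left hγ1 (by positivity : 0 ≤ P₀ * (ε * E₀))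
  have b1 : 0 ≤ P₀ * γ * F₀ := by positivity
  have b2 : 0 ≤ P₁ * F₁ := by positivity
  have b3 := mul_le_mul_of_nonneg_left hav hε.le
  have b4 : m * (1 - γ) * B ≤ P₀ * (1 - γ) * B :=
    mul_le_mul_of_nonneg_right (mul_le_mul_of_nonneg_right hm (by linarith)) hB
  have b5 : (P₀ + P₁) * B = B := by rw [hP, one_mul]
  have b6 : 0 < s * F := mul_pos hs hF
  have b7 : s * (ε * E) ≤ (1 - r) * (ε * E) :=
    mul_le_mul_of_nonneg_right (by linarith) (by positivity)
  linarith

/-- There is a weight `V` such that `V x` times the `logit`-distance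
of `x` and `y` is contracted on average in one step, for `x` and `y` close to each other. -/
lemma exists_contracting_weight (hA1 : A1 x₀ y₀) (hA3 : A3 p₀ p₁) (hA4 : A4 x₀ y₀ p₀ p₁) :
    ∃ η : ℝ, 0 < η ∧ ∃ q ∈ Ioo (0 : ℝ) 1, ∃ V : ℝ → ℝ, (∀ x, 1 ≤ V x) ∧
      (∃ C : ℝ, ∀ x ∈ Icc (1 - x₀) x₀, V x ≤ C) ∧
      ∀ x ∈ Ioo (0 : ℝ) 1, ∀ y ∈ Ioo (0 : ℝ) 1, |logit x - logit y| < η →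
        coupled x₀ y₀ p₀ p₁ (fun x y => V x * |logit x - logit y|) x y ≤
          q * (V x * |logit x - logit y|) := by
  obtain ⟨α, hα, r, ⟨hr0, hr1⟩, b, hb, hdrift⟩ := exists_drift hA1 hA3 hA4
  obtain ⟨m, hm, hpm⟩ := exists_prob_lower_bound hA3
  obtain ⟨u, hu_mem, hw0, η, hη, γ, hγ0, hγ1, hwin⟩ := exists_contracting_window hA1
  have hA11 := hA1.1
  have hA12 := hA1.2.1
  have hc : 0 < -Real.log (y₀ / x₀) :=
    neg_pos.2 (Real.log_neg (slope_left_pos hA1) (slope_left_lt_one hA1))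
  have hf1u_mem := f1_mem hA1 hu_mem
  have hmono := strictMonoOn_logit.monotoneOn
  set w := logit (f1 x₀ y₀ u) with hw
  obtain ⟨φ, hφ0, ⟨M, hM⟩, hφR, hφl, hφr⟩ :=
    exists_growth_function (l := Real.log ((1 - y₀) / (1 - x₀))) hm hc hw0
  set R := 2 * b / (1 - r) / α with hR
  obtain ⟨φ₀, hφ₀, hφ₀R⟩ := hφR R
  have hm1 : m ≤ 1 := (hpm 0 (by norm_num)).1.trans (hA3.2.2 0 (by norm_num)).2.2.1.le
  obtain ⟨ε, B, s, hε0, hs0, hs1, hεb, hBM, hsr, hsφ, hsε, hsδ⟩ :=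
    exists_weight_constants (δ := m * (1 - γ)) hr1 hb (mul_pos hm (by linarith)) (by nlinarith)
      hφ₀ ((hφ0 0).trans_le (hM 0))
  have hB0 : 0 < B := by linarith [hφ0 0, hM 0]
  set V : ℝ → ℝ := fun x => B - φ (logit x) + ε * Real.exp (α * |logit x|) with hV
  have hV1 : ∀ x, 1 ≤ V x := fun x => by
    have h1 := hM (logit x)
    have h2 : 0 < ε * Real.exp (α * |logit x|) := by positivity
    simp only [hV]
    linarith
  refine ⟨η, hη, 1 - s, ⟨by linarith, by linarith⟩, V, hV1,
    ⟨B + ε * Real.exp (α * logit x₀), fun x hx => ?_⟩, fun x hx y hy hxy => ?_⟩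
  · have hx' : x ∈ Ioo (0 : ℝ) 1 := ⟨by linarith [hx.1], by linarith [hx.2]⟩
    have hx₀ : x₀ ∈ Ioo (0 : ℝ) 1 := ⟨by linarith, by linarith⟩
    have h1 := hmono hx' hx₀ hx.2
    have h2 := hmono (one_sub_mem hx₀) hx' hx.1
    rw [logit_one_sub] at h2
    have h3 : Real.exp (α * |logit x|) ≤ Real.exp (α * logit x₀) :=
      Real.exp_le_exp.2 (mul_le_mul_of_nonneg_left (abs_le.2 ⟨by linarith, h1⟩) hα.le)
    simp only [hV]
    nlinarith [hφ0 (logit x)]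
  · have hdr := hdrift x hx
    obtain ⟨hps, hp₀, -, hp₁, -⟩ := hA3.2.2 x (Ioo_subset_Icc_self hx)
    obtain ⟨hm₀, hm₁⟩ := hpm x (Ioo_subset_Icc_self hx)
    have hρ0 := abs_logit_f0_sub_le hA1 hx hy
    have hρ1 := abs_logit_f1_sub_le hA1 hx hy
    have hρ := abs_nonneg (logit x - logit y)
    have d1 := disp_ge hA1 hx
    have d2 := disp_le hA1 hx
    have d3 := disp_ge hA1 (one_sub_mem hx)
    have hE : 1 ≤ Real.exp (α * |logit x|) := Real.one_le_exp (by positivity)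
    have hV0 := hV1 (f0 x₀ y₀ x)
    have hV1' := hV1 (f1 x₀ y₀ x)
    have finish : ∀ k : ℝ, |logit (f0 x₀ y₀ x) - logit (f0 x₀ y₀ y)| ≤
        k * |logit x - logit y| →
        p₀ x * V (f0 x₀ y₀ x) * k + p₁ x * V (f1 x₀ y₀ x) ≤ (1 - s) * V x →
        coupled x₀ y₀ p₀ p₁ (fun x y => V x * |logit x - logit y|) x y ≤
          (1 - s) * (V x * |logit x - logit y|) := fun k hk hVk => by
      rw [coupled, ← mul_assoc, ← mul_assoc, ← mul_assoc]
      have e0 := mul_le_mul_of_nonneg_left hk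
        (by positivity : 0 ≤ p₀ x * V (f0 x₀ y₀ x))
      have e1 := mul_le_mul_of_nonneg_left hρ1
        (by positivity : 0 ≤ p₁ x * V (f1 x₀ y₀ x))
      have e2 := mul_le_mul_of_nonneg_right hVk hρ
      linarith
    have outside : 2 * φ (logit x) ≤
        p₀ x * φ (logit (f0 x₀ y₀ x)) + p₁ x * φ (logit (f1 x₀ y₀ x)) →
        coupled x₀ y₀ p₀ p₁ (fun x y => V x * |logit x - logit y|) x y ≤
          (1 - s) * (V x * |logit x - logit y|) := fun hφ2 => by
      refine finish 1 (by rwa [one_mul]) ?_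
      have hav : p₀ x * V (f0 x₀ y₀ x) * 1 + p₁ x * V (f1 x₀ y₀ x) ≤
          B - 2 * φ (logit x) + ε * (r * Real.exp (α * |logit x|) + b) := by
        have e := mul_le_mul_of_nonneg_left hdr hε0.le
        simp only [hV]
        linear_combination e + hφ2 + B * hps
      refine hav.trans ?_
      simp only [hV]
      refine weight_average_le_of_growth hr1 (hφ0 _) hε0 hs0 hE hsr hεb hsφ hsε ?_
      rcases le_total |logit x| R with hR' | hR'
      · exact .inl (hφ₀R _ hR')
      · right
        have h1 := Real.add_one_le_exp (α * |logit x|)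
        have h2 := mul_le_mul_of_nonneg_left hR' hα.le
        have h3 : α * R = 2 * b / (1 - r) := mul_div_cancel₀ _ hα.ne'
        have h4 : 2 * b / (1 - r) ≤ Real.exp (α * |logit x|) := by linarith
        rw [div_le_iff₀ (by linarith)] at h4
        linarith
    rcases le_or_gt x u with hxu | hxu
    · apply outside
      have hle : logit (f1 x₀ y₀ x) ≤ w := hmono (f1_mem hA1 hx) hf1u_mem (monotone_f1 hA1 hxu)
      have h := hφl (logit x) (logit (f1 x₀ y₀ x)) (by rw [logit_f1]; linarith) hle
      have h1 := mul_pos hp₀ (hφ0 (logit (f0 x₀ y₀ x)))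
      have h2 := mul_le_mul_of_nonneg_right hm₁ (hφ0 (logit (f1 x₀ y₀ x))).le
      linarith
    rcases le_or_gt x (f1 x₀ y₀ u) with hxw | hxw
    · exact finish γ (hwin x hx y hy hxu hxw hxy)
        (weight_average_le_of_contraction hps hm₀ hp₀.le hp₁.le hγ0 hγ1.le hB0.le (hφ0 _) (hM _)
          (hφ0 _) (hφ0 _) (Real.exp_pos _).le (Real.exp_pos _).le hε0 hs0 hsr hdr hsδ)
    · apply outside
      have hlt : w < logit x := strictMonoOn_logit hf1u_mem hx hxw
      have h := hφr (logit x) (logit (f0 x₀ y₀ x)) hlt (by rw [logit_f0]; linarith)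
        (by rw [logit_f0]; linarith)
      have h1 := mul_pos hp₁ (hφ0 (logit (f1 x₀ y₀ x)))
      have h2 := mul_le_mul_of_nonneg_right hm₀ (hφ0 (logit (f0 x₀ y₀ x))).le
      linarith

end Weight

end AM

/-- Proposition 2: under (A1)–(A4) there exist `η₂ > 0`, `L ≥ 1`, `q ∈ (0,1)`
such that `𝔼_x |f^n_ω(x) − f^n_ω(y)| ≤ L qⁿ |x − y|` for all `x, y ∈ [1−x₀, x₀]` with
`|x − y| < η₂` and all `n`. -/
theorem stmt9 (x₀ y₀ : ℝ) (p₀ p₁ : ℝ → ℝ)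
    (hA1 : AM.A1 x₀ y₀) (hA2 : AM.A2 p₀ p₁) (hA3 : AM.A3 p₀ p₁) (hA4 : AM.A4 x₀ y₀ p₀ p₁)
    (Pm : ℝ → MeasureTheory.Measure (ℕ → Bool)) (hPm : AM.IsKernel x₀ y₀ p₀ p₁ Pm) :
    ∃ η₂ : ℝ, 0 < η₂ ∧ ∃ L : ℝ, 1 ≤ L ∧ ∃ q : ℝ, q ∈ Set.Ioo (0:ℝ) 1 ∧
      ∀ x ∈ Set.Icc (1 - x₀) x₀, ∀ y ∈ Set.Icc (1 - x₀) x₀, |x - y| < η₂ →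
        ∀ n : ℕ,
          (∫ ω, |AM.iter x₀ y₀ ω n x - AM.iter x₀ y₀ ω n y| ∂(Pm x)) ≤
            L * q ^ n * |x - y| := by
  obtain ⟨η, hη, q, hq, V, hV1, ⟨C, hC⟩, hW⟩ := AM.exists_contracting_weight hA1 hA3 hA4
  obtain ⟨hx₀, hx₀', -, -⟩ := id hA1
  have hd : 0 < 1 - x₀ := by linarith
  have hmaps : ∀ b, MapsTo (AM.fb x₀ y₀ b) (Ioo 0 1) (Ioo 0 1) := by
    intro b x hx
    cases b
    · exact AM.f0_mem hA1 hx
    · exact AM.f1_mem hA1 hx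
  have hp : ∀ x ∈ Ioo (0 : ℝ) 1, 0 ≤ p₀ x ∧ 0 ≤ p₁ x := fun x hx =>
    have h := hA3.2.2 x (Ioo_subset_Icc_self hx)
    ⟨h.2.1.le, h.2.2.2.1.le⟩
  have key : ∀ n : ℕ, ∀ x ∈ Ioo (0 : ℝ) 1, ∀ y ∈ Ioo (0 : ℝ) 1,
      |AM.logit x - AM.logit y| < η →
      (AM.coupled x₀ y₀ p₀ p₁)^[n] (fun x y => |x - y|) x y ≤
        q ^ n * (V x * |AM.logit x - AM.logit y|) := by
    intro n
    induction n with
    | zero =>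
      intro x hx y hy _
      have h := AM.abs_sub_le_abs_logit_sub hx hy
      have h' := le_mul_of_one_le_left (abs_nonneg (AM.logit x - AM.logit y)) (hV1 x)
      simpa using h.trans h'
    | succ n ih =>
      intro x hx y hy hxy
      rw [Function.iterate_succ_apply', AM.coupled]
      have h0 := ih _ (AM.f0_mem hA1 hx) _ (AM.f0_mem hA1 hy)
        ((AM.abs_logit_f0_sub_le hA1 hx hy).trans_lt hxy)
      have h1 := ih _ (AM.f1_mem hA1 hx) _ (AM.f1_mem hA1 hy)
        ((AM.abs_logit_f1_sub_le hA1 hx hy).trans_lt hxy)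
      have h2 := mul_le_mul_of_nonneg_left (hW x hx y hy hxy) (pow_nonneg hq.1.le n)
      rw [AM.coupled] at h2
      calc _ ≤ _ := add_le_add (mul_le_mul_of_nonneg_left h0 (hp x hx).1)
            (mul_le_mul_of_nonneg_left h1 (hp x hx).2)
        _ ≤ q ^ n * (q * (V x * |AM.logit x - AM.logit y|)) := by linarith
        _ = _ := by ring
  refine ⟨η * (1 - x₀), mul_pos hη hd, max 1 (C * (1 / (1 - x₀))), le_max_left _ _, q, hq,
    fun x hx y hy hxy n => ?_⟩
  have hsub : Icc (1 - x₀) x₀ ⊆ Ioo (0 : ℝ) 1 := fun z hz =>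
    ⟨by linarith [hz.1], by linarith [hz.2]⟩
  have hlip := AM.abs_logit_sub_le hd (x := x) (y := y) (by rwa [sub_sub_cancel])
    (by rwa [sub_sub_cancel])
  have hclose : |AM.logit x - AM.logit y| < η := by
    refine hlip.trans_lt ?_
    rwa [one_div, inv_mul_lt_iff₀ hd, mul_comm]
  rw [AM.integral_iter_eq hPm (fun x hx => (hp x hx).1) (fun x hx => (hp x hx).2) hmaps
    (fun x y => |x - y|) n (hsub hx) y]
  have hVρ : V x * |AM.logit x - AM.logit y| ≤ max 1 (C * (1 / (1 - x₀))) * |x - y| := by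
    have hC0 : 0 ≤ C := zero_le_one.trans ((hV1 x).trans (hC x hx))
    calc _ ≤ C * (1 / (1 - x₀) * |x - y|) := mul_le_mul (hC x hx) hlip (abs_nonneg _) hC0
      _ = C * (1 / (1 - x₀)) * |x - y| := by ring
      _ ≤ _ := mul_le_mul_of_nonneg_right (le_max_right _ _) (abs_nonneg _)
  calc _ ≤ _ := key n x (hsub hx) y (hsub hy) hclose
    _ ≤ q ^ n * (max 1 (C * (1 / (1 - x₀))) * |x - y|) :=
        mul_le_mul_of_nonneg_left hVρ (pow_nonneg hq.1.le n)
    _ = _ := by ring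
end

section
/- Let ε ∈ (0, 1−x₀), α ∈ (0,1) and p ∈ (0,1) satisfy sup_{t≤ε} p₀(t)·a₀^{−α} + sup_{t≤ε} p₁(t)·a₁^{−α} < p and sup_{t≤ε} p₀(1−t)·a₁^{−α} + sup_{t≤ε} p₁(1−t)·a₀^{−α} < p. Then for every x with 0 < x < ε and every natural number n: ℙ_x({ω ∈ Σ : f^j_ω(x) < ε for all 1 ≤ j ≤ n}) ≤ (ε/x)^α·pⁿ, and likewise ℙ_{1−x}({ω ∈ Σ : f^j_ω(1−x) > 1−ε for all 1 ≤ j ≤ n}) ≤ (ε/x)^α·pⁿ. -/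
/-
Formalization of the Alsedà–Misiurewicz system setup:
`f0, f1` are the piecewise-linear interval homeomorphisms, `iter` the random
iteration along ω ∈ Σ = {0,1}^ℕ, `IsKernel` characterises the family x ↦ ℙ_x by
its values on cylinder sets, `Pop` is the Markov operator (as a set function),
`Stationary` expresses P-invariance for probability measures on (0,1), `U` is
the dual operator, and `A1`–`A4` are the assumptions of the paper.
-/

open MeasureTheory Filter Set
open scoped ENNReal Topology

namespace AM

/-- The endpoint of the orbit of `x` along the word `w`. -/
noncomputable def wordMap (x₀ y₀ : ℝ) (x : ℝ) (w : List Bool) : ℝ :=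
  w.foldl (fun z b => fb x₀ y₀ b z) x

/-- The probability of applying the map with index `b` at the point `y`. -/
def weight (p₀ p₁ : ℝ → ℝ) (b : Bool) (y : ℝ) : ℝ := if b then p₁ y else p₀ y

lemma wordMap_append_singleton (x₀ y₀ x : ℝ) (w : List Bool) (b : Bool) :
    wordMap x₀ y₀ x (w ++ [b]) = fb x₀ y₀ b (wordMap x₀ y₀ x w) := by
  simp [wordMap]

lemma cylProb_append_singleton (x₀ y₀ : ℝ) (p₀ p₁ : ℝ → ℝ) (w : List Bool) (b : Bool) (x : ℝ) :
    cylProb x₀ y₀ p₀ p₁ x (w ++ [b]) =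
      cylProb x₀ y₀ p₀ p₁ x w * weight p₀ p₁ b (wordMap x₀ y₀ x w) := by
  induction w generalizing x with
  | nil => simp [cylProb, wordMap, weight]
  | cons c w ih =>
    simp only [List.cons_append, cylProb, ih, mul_assoc]
    rfl

lemma mem_cyl_iff {w : List Bool} {ω : ℕ → Bool} :
    ω ∈ cyl w ↔ ∀ (j : ℕ) (hj : j < w.length), ω j = w[j] :=
  ⟨fun h j hj => h ⟨j, hj⟩, fun h j => h j j.2⟩

lemma mem_cyl_append_singleton {w : List Bool} {b : Bool} {ω : ℕ → Bool} :
    ω ∈ cyl (w ++ [b]) ↔ ω ∈ cyl w ∧ ω w.length = b := by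
  simp only [mem_cyl_iff]
  constructor
  · intro h
    refine ⟨fun j hj => ?_, ?_⟩
    · rw [h j (by simp; omega), List.getElem_append_left hj]
    · rw [h w.length (by simp)]
      simp
  · rintro ⟨h, hb⟩ j hj
    rcases Nat.lt_or_ge j w.length with hlt | hge
    · rw [h j hlt, List.getElem_append_left hlt]
    · obtain rfl : j = w.length := by simp at hj; omega
      simpa using hb

lemma iter_eq_wordMap (x₀ y₀ x : ℝ) {ω : ℕ → Bool} (w : List Bool) (h : ω ∈ cyl w) :
    iter x₀ y₀ ω w.length x = wordMap x₀ y₀ x w := by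
  induction w using List.reverseRecOn with
  | nil => rfl
  | append_singleton w b ih =>
    obtain ⟨hw, rfl⟩ := mem_cyl_append_singleton.1 h
    rw [wordMap_append_singleton, ← ih hw, List.length_append]
    rfl

/-- Sequences in the cylinder of `w` whose orbit of `x` stays in `V` for `n` further steps. -/
def survival (x₀ y₀ x : ℝ) (V : Set ℝ) (w : List Bool) (n : ℕ) : Set (ℕ → Bool) :=
  {ω | ω ∈ cyl w ∧ ∀ j, w.length < j → j ≤ w.length + n → iter x₀ y₀ ω j x ∈ V}

lemma survival_succ_subset (x₀ y₀ x : ℝ) (V : Set ℝ) (w : List Bool) (n : ℕ) :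
    survival x₀ y₀ x V w (n + 1) ⊆
      survival x₀ y₀ x V (w ++ [false]) n ∪ survival x₀ y₀ x V (w ++ [true]) n := by
  rintro ω ⟨hw, hV⟩
  have key : ω ∈ survival x₀ y₀ x V (w ++ [ω w.length]) n := by
    refine ⟨mem_cyl_append_singleton.2 ⟨hw, rfl⟩, fun j hj hj' => hV j ?_ ?_⟩ <;>
      simp only [List.length_append, List.length_singleton] at hj hj' <;> omega
  cases hb : ω w.length <;> rw [hb] at key
  · exact Or.inl key
  · exact Or.inr key

lemma wordMap_mem_of_mem_survival (x₀ y₀ x : ℝ) (V : Set ℝ) (w : List Bool) (b : Bool) (n : ℕ)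
    {ω : ℕ → Bool} (h : ω ∈ survival x₀ y₀ x V w (n + 1)) (hb : ω ∈ cyl (w ++ [b])) :
    wordMap x₀ y₀ x (w ++ [b]) ∈ V := by
  rw [← iter_eq_wordMap x₀ y₀ x _ hb]
  apply h.2 <;> simp

/-- If `φ ≥ 1` on `B` and `U φ ≤ p φ` on `B`, then the probability that an orbit starting in `B`
stays in `V` for `n` steps is at most `φ pⁿ`, provided orbits can only leave `B` by leaving `V`. -/
lemma measure_survival_le {x₀ y₀ : ℝ} {p₀ p₁ : ℝ → ℝ} {Pm : ℝ → Measure (ℕ → Bool)}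
    (hPm : IsKernel x₀ y₀ p₀ p₁ Pm) {B V : Set ℝ} {φ : ℝ → ℝ} {p : ℝ} (hp : 0 ≤ p)
    (hBV : ∀ y ∈ B, ∀ b, fb x₀ y₀ b y ∈ V → fb x₀ y₀ b y ∈ B)
    (hw : ∀ y ∈ B, ∀ b, 0 ≤ weight p₀ p₁ b y)
    (hφ : ∀ y ∈ B, ∀ b, 0 ≤ φ (fb x₀ y₀ b y)) (hφ1 : ∀ y ∈ B, 1 ≤ φ y)
    (hU : ∀ y ∈ B, U x₀ y₀ p₀ p₁ φ y ≤ p * φ y)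
    {x : ℝ} (hx : x ∈ Ioo (0 : ℝ) 1) (n : ℕ) (w : List Bool)
    (hy : wordMap x₀ y₀ x w ∈ B) (hc : 0 ≤ cylProb x₀ y₀ p₀ p₁ x w) :
    Pm x (survival x₀ y₀ x V w n) ≤
      ENNReal.ofReal (cylProb x₀ y₀ p₀ p₁ x w * (φ (wordMap x₀ y₀ x w) * p ^ n)) := by
  induction n generalizing w with
  | zero =>
    calc Pm x (survival x₀ y₀ x V w 0) ≤ Pm x (cyl w) := measure_mono fun ω h => h.1
      _ = ENNReal.ofReal (cylProb x₀ y₀ p₀ p₁ x w) := hPm x hx w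
      _ ≤ _ := by
        refine ENNReal.ofReal_le_ofReal (le_mul_of_one_le_right hc ?_)
        simpa using hφ1 _ hy
  | succ n ih =>
    set y := wordMap x₀ y₀ x w with hydef
    set c := cylProb x₀ y₀ p₀ p₁ x w
    have hnn : ∀ b, 0 ≤ c * weight p₀ p₁ b y * (φ (fb x₀ y₀ b y) * p ^ n) := fun b =>
      mul_nonneg (mul_nonneg hc (hw y hy b)) (mul_nonneg (hφ y hy b) (pow_nonneg hp n))
    have step : ∀ b, Pm x (survival x₀ y₀ x V w (n + 1) ∩ survival x₀ y₀ x V (w ++ [b]) n) ≤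
        ENNReal.ofReal (c * weight p₀ p₁ b y * (φ (fb x₀ y₀ b y) * p ^ n)) := by
      intro b
      by_cases hb : fb x₀ y₀ b y ∈ V
      · have := ih (w ++ [b]) (by rw [wordMap_append_singleton]; exact hBV y hy b hb)
          (by rw [cylProb_append_singleton]; exact mul_nonneg hc (hw y hy b))
        rw [cylProb_append_singleton, wordMap_append_singleton] at this
        exact (measure_mono inter_subset_right).trans this
      · have hempty : survival x₀ y₀ x V w (n + 1) ∩ survival x₀ y₀ x V (w ++ [b]) n = ∅ := by
          refine eq_empty_of_forall_notMem fun ω h => hb ?_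
          rw [hydef, ← wordMap_append_singleton]
          exact wordMap_mem_of_mem_survival x₀ y₀ x V w b n h.1 h.2.1
        simp [hempty]
    calc Pm x (survival x₀ y₀ x V w (n + 1))
        ≤ Pm x ((survival x₀ y₀ x V w (n + 1) ∩ survival x₀ y₀ x V (w ++ [false]) n) ∪
            (survival x₀ y₀ x V w (n + 1) ∩ survival x₀ y₀ x V (w ++ [true]) n)) := by
          rw [← inter_union_distrib_left]
          exact measure_mono fun ω h => ⟨h, survival_succ_subset x₀ y₀ x V w n h⟩
      _ ≤ _ := (measure_union_le _ _).trans (add_le_add (step false) (step true))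
      _ = ENNReal.ofReal (c * (U x₀ y₀ p₀ p₁ φ y * p ^ n)) := by
          rw [← ENNReal.ofReal_add (hnn false) (hnn true)]
          congr 1
          simp only [weight, U, fb, Bool.false_eq_true, if_true, if_false]
          ring
      _ ≤ _ := by
          refine ENNReal.ofReal_le_ofReal (mul_le_mul_of_nonneg_left ?_ hc)
          calc U x₀ y₀ p₀ p₁ φ y * p ^ n ≤ p * φ y * p ^ n :=
                mul_le_mul_of_nonneg_right (hU y hy) (pow_nonneg hp n)
            _ = φ y * p ^ (n + 1) := by ring

/-- `measure_survival_le` for the whole sequence space. -/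
lemma measure_orbit_mem_le {x₀ y₀ : ℝ} {p₀ p₁ : ℝ → ℝ} {Pm : ℝ → Measure (ℕ → Bool)}
    (hPm : IsKernel x₀ y₀ p₀ p₁ Pm) {B V : Set ℝ} {φ : ℝ → ℝ} {p : ℝ} (hp : 0 ≤ p)
    (hBV : ∀ y ∈ B, ∀ b, fb x₀ y₀ b y ∈ V → fb x₀ y₀ b y ∈ B)
    (hw : ∀ y ∈ B, ∀ b, 0 ≤ weight p₀ p₁ b y)
    (hφ : ∀ y ∈ B, ∀ b, 0 ≤ φ (fb x₀ y₀ b y)) (hφ1 : ∀ y ∈ B, 1 ≤ φ y)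
    (hU : ∀ y ∈ B, U x₀ y₀ p₀ p₁ φ y ≤ p * φ y)
    {x : ℝ} (hx : x ∈ Ioo (0 : ℝ) 1) (hxB : x ∈ B) (n : ℕ) :
    Pm x {ω | ∀ j, 1 ≤ j → j ≤ n → iter x₀ y₀ ω j x ∈ V} ≤ ENNReal.ofReal (φ x * p ^ n) := by
  have h := measure_survival_le hPm (V := V) hp hBV hw hφ hφ1 hU hx n [] hxB zero_le_one
  simp only [cylProb, wordMap, List.foldl_nil, one_mul] at h
  refine (measure_mono fun ω hω => ?_).trans h
  exact ⟨fun j => j.elim0, fun j hj hj' => hω j hj (by simpa using hj')⟩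

lemma f0_of_le {x₀ y₀ y : ℝ} (h : y ≤ x₀) : f0 x₀ y₀ y = y₀ / x₀ * y := if_pos h

lemma one_sub_f0_of_lt {x₀ y₀ y : ℝ} (h : x₀ < y) :
    1 - f0 x₀ y₀ y = (1 - y₀) / (1 - x₀) * (1 - y) := by
  rw [f0, if_neg h.not_ge]
  ring

lemma div_mul_rpow_eq {ε a t α : ℝ} (hε : 0 ≤ ε) (ha : 0 < a) (ht : 0 ≤ t) :
    (ε / (a * t)) ^ α = a ^ (-α) * (ε / t) ^ α := by
  rw [show ε / (a * t) = a⁻¹ * (ε / t) by field_simp, Real.mul_rpow (by positivity) (by positivity),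
    Real.inv_rpow ha.le, Real.rpow_neg ha.le]

lemma weighted_power_le {S T q r a b ε t α p : ℝ} (hq : q ≤ S) (hr : r ≤ T) (ha : 0 < a)
    (hb : 0 < b) (hε : 0 ≤ ε) (ht : 0 ≤ t) (h : S * a ^ (-α) + T * b ^ (-α) < p) :
    q * (ε / (a * t)) ^ α + r * (ε / (b * t)) ^ α ≤ p * (ε / t) ^ α := by
  rw [div_mul_rpow_eq hε ha ht, div_mul_rpow_eq hε hb ht]
  have h' : q * a ^ (-α) + r * b ^ (-α) ≤ p := le_trans (by gcongr) h.le
  calc _ = (q * a ^ (-α) + r * b ^ (-α)) * (ε / t) ^ α := by ring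
    _ ≤ _ := by gcongr

lemma le_sSup_image_of_continuousOn {q : ℝ → ℝ} {s : Set ℝ} {a b y : ℝ} (hq : ContinuousOn q s)
    (hs : Icc a b ⊆ s) (hy : y ∈ Icc a b) : q y ≤ sSup (q '' Icc a b) :=
  le_csSup (isCompact_Icc.image_of_continuousOn (hq.mono hs)).bddAbove (mem_image_of_mem q hy)

lemma one_le_div_rpow {ε t α : ℝ} (ht : 0 < t) (htε : t < ε) (hα : 0 ≤ α) : 1 ≤ (ε / t) ^ α :=
  Real.one_le_rpow ((one_le_div ht).2 htε.le) hα

lemma weight_nonneg {p₀ p₁ : ℝ → ℝ} (h : A3 p₀ p₁) {y : ℝ} (hy : y ∈ Icc (0 : ℝ) 1) (b : Bool) :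
    0 ≤ weight p₀ p₁ b y := by
  obtain ⟨-, h0, -, h1, -⟩ := h.2.2 y hy
  cases b
  · exact h0.le
  · exact h1.le

end AM

/-- Lemma 3: if `ε ∈ (0, 1−x₀)`, `α, p ∈ (0,1)` satisfy
`sup_(t≤ε) p₀(t) a₀^(−α) + sup_(t≤ε) p₁(t) a₁^(−α) < p` and
`sup_(t≤ε) p₀(1−t) a₁^(−α) + sup_(t≤ε) p₁(1−t) a₀^(−α) < p`, then for `0 < x < ε` and all `n`,
`ℙ_x(f^j_ω(x) < ε for 1 ≤ j ≤ n) ≤ (ε/x)^α pⁿ`, and likewise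
`ℙ_(1−x)(f^j_ω(1−x) > 1−ε for 1 ≤ j ≤ n) ≤ (ε/x)^α pⁿ`. -/
theorem stmt10 (x₀ y₀ : ℝ) (p₀ p₁ : ℝ → ℝ)
    (hA1 : AM.A1 x₀ y₀) (hA3 : AM.A3 p₀ p₁)
    (Pm : ℝ → MeasureTheory.Measure (ℕ → Bool)) (hPm : AM.IsKernel x₀ y₀ p₀ p₁ Pm)
    (ε α p : ℝ) (hε : 0 < ε) (hε' : ε < 1 - x₀)
    (hα : α ∈ Set.Ioo (0:ℝ) 1) (hp : p ∈ Set.Ioo (0:ℝ) 1)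
    (h1 : sSup (p₀ '' Set.Icc 0 ε) * (y₀ / x₀) ^ (-α) +
          sSup (p₁ '' Set.Icc 0 ε) * ((1 - y₀) / (1 - x₀)) ^ (-α) < p)
    (h2 : sSup (p₀ '' Set.Icc (1 - ε) 1) * ((1 - y₀) / (1 - x₀)) ^ (-α) +
          sSup (p₁ '' Set.Icc (1 - ε) 1) * (y₀ / x₀) ^ (-α) < p) :
    ∀ x : ℝ, 0 < x → x < ε → ∀ n : ℕ,
      Pm x {ω : ℕ → Bool | ∀ j : ℕ, 1 ≤ j → j ≤ n → AM.iter x₀ y₀ ω j x < ε} ≤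
        ENNReal.ofReal ((ε / x) ^ α * p ^ n) ∧
      Pm (1 - x) {ω : ℕ → Bool | ∀ j : ℕ, 1 ≤ j → j ≤ n →
          1 - ε < AM.iter x₀ y₀ ω j (1 - x)} ≤
        ENNReal.ofReal ((ε / x) ^ α * p ^ n) := by
  obtain ⟨hx0, hx1, hy0, hyx⟩ := hA1
  have ha0 : 0 < y₀ / x₀ := div_pos (by linarith) (by linarith)
  have ha1 : 0 < (1 - y₀) / (1 - x₀) := div_pos (by linarith) (by linarith)
  intro x hx hxε n
  have hleft : ∀ y ∈ Ioo 0 ε, AM.f0 x₀ y₀ y = y₀ / x₀ * y ∧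
      AM.f1 x₀ y₀ y = (1 - y₀) / (1 - x₀) * y := fun y hy => by
    refine ⟨AM.f0_of_le (by linarith [hy.2]), ?_⟩
    rw [AM.f1, AM.one_sub_f0_of_lt (by linarith [hy.2]), sub_sub_cancel]
  have hright : ∀ y ∈ Ioo (1 - ε) 1, 1 - AM.f0 x₀ y₀ y = (1 - y₀) / (1 - x₀) * (1 - y) ∧
      1 - AM.f1 x₀ y₀ y = y₀ / x₀ * (1 - y) := fun y hy => by
    refine ⟨AM.one_sub_f0_of_lt (by linarith [hy.1]), ?_⟩
    rw [AM.f1, AM.f0_of_le (by linarith [hy.1]), sub_sub_cancel]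
  have hleft_pos : ∀ y ∈ Ioo 0 ε, ∀ b, 0 < AM.fb x₀ y₀ b y := fun y hy b => by
    cases b
    · exact (mul_pos ha0 hy.1).trans_eq (hleft y hy).1.symm
    · exact (mul_pos ha1 hy.1).trans_eq (hleft y hy).2.symm
  have hright_pos : ∀ y ∈ Ioo (1 - ε) 1, ∀ b, 0 < 1 - AM.fb x₀ y₀ b y := fun y hy b => by
    cases b
    · exact (mul_pos ha1 (sub_pos.2 hy.2)).trans_eq (hright y hy).1.symm
    · exact (mul_pos ha0 (sub_pos.2 hy.2)).trans_eq (hright y hy).2.symm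
  have hsub : Icc 0 ε ⊆ Icc (0 : ℝ) 1 := Icc_subset_Icc_right (by linarith)
  have hsub' : Icc (1 - ε) 1 ⊆ Icc (0 : ℝ) 1 := Icc_subset_Icc_left (by linarith)
  constructor
  · refine AM.measure_orbit_mem_le hPm (B := Ioo 0 ε) (V := Iio ε) (φ := fun y => (ε / y) ^ α)
      hp.1.le (fun y hy b hb => ⟨hleft_pos y hy b, hb⟩)
      (fun y hy b => AM.weight_nonneg hA3 (hsub (Ioo_subset_Icc_self hy)) b)
      (fun y hy b => Real.rpow_nonneg (div_pos hε (hleft_pos y hy b)).le α)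
      (fun y hy => AM.one_le_div_rpow hy.1 hy.2 hα.1.le) (fun y hy => ?_)
      ⟨hx, by linarith⟩ ⟨hx, hxε⟩ n
    have hy' := Ioo_subset_Icc_self hy
    simp only [AM.U, (hleft y hy).1, (hleft y hy).2]
    exact AM.weighted_power_le (AM.le_sSup_image_of_continuousOn hA3.1 hsub hy')
      (AM.le_sSup_image_of_continuousOn hA3.2.1 hsub hy') ha0 ha1 hε.le hy.1.le h1
  · have h := AM.measure_orbit_mem_le hPm (B := Ioo (1 - ε) 1) (V := Ioi (1 - ε))
      (φ := fun y => (ε / (1 - y)) ^ α) hp.1.le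
      (fun y hy b hb => ⟨hb, sub_pos.1 (hright_pos y hy b)⟩)
      (fun y hy b => AM.weight_nonneg hA3 (hsub' (Ioo_subset_Icc_self hy)) b)
      (fun y hy b => Real.rpow_nonneg (div_pos hε (hright_pos y hy b)).le α)
      (fun y hy => AM.one_le_div_rpow (sub_pos.2 hy.2) (by linarith [hy.1]) hα.1.le)
      (fun y hy => ?_) (x := 1 - x) ⟨by linarith, by linarith⟩ ⟨by linarith, by linarith⟩ n
    · simpa only [sub_sub_cancel, mem_Ioi] using h
    have hy' := Ioo_subset_Icc_self hy
    simp only [AM.U, (hright y hy).1, (hright y hy).2]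
    exact AM.weighted_power_le (AM.le_sSup_image_of_continuousOn hA3.1 hsub' hy')
      (AM.le_sSup_image_of_continuousOn hA3.2.1 hsub' hy') ha1 ha0 hε.le (sub_pos.2 hy.2).le h2
end
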